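/- Let n ≥ 1, s ∈ ℝ and 1 ≤ p, q ≤ ∞ with p ≠ q. If s > n|1/p − 1/q| (with the convention 1/∞ = 0), then there exists a constant C > 0 such that ‖e^{iΔ}f‖_{W_{p,q}} ≤ C‖f‖_{W^s_{p,q}} for all f ∈ 𝒮(ℝⁿ). -/

import Mathlib

open MeasureTheory Real
open scoped ENNReal RealInnerProductSpace

noncomputable section

/-- The short-time Fourier transform
`V_g f (x, ξ) = ∫ e^{-i ξ·t} conj (g (t - x)) f t dt`. -/
def STFT {n : ℕ} (g f : EuclideanSpace ℝ (Fin n) → ℂ)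
    (x ξ : EuclideanSpace ℝ (Fin n)) : ℂ :=
  ∫ t : EuclideanSpace ℝ (Fin n),
    Complex.exp (-(Complex.I * Complex.ofReal ⟪ξ, t⟫)) * (starRingEnd ℂ) (g (t - x)) * f t

/-- The Fourier transform `f̂ (ξ) = ∫ e^{-i ξ·x} f x dx`. -/
def FT {n : ℕ} (f : EuclideanSpace ℝ (Fin n) → ℂ) (ξ : EuclideanSpace ℝ (Fin n)) : ℂ :=
  ∫ x : EuclideanSpace ℝ (Fin n),
    Complex.exp (-(Complex.I * Complex.ofReal ⟪ξ, x⟫)) * f x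

/-- The power of the Japanese bracket `⟨x⟩ˢ = (1 + |x|²)^(s/2)`. -/
def jp {n : ℕ} (s : ℝ) (x : EuclideanSpace ℝ (Fin n)) : ℝ := (1 + ‖x‖ ^ 2) ^ (s / 2)

/-- The Gaussian window `g₀ (t) = e^{-|t|²}`. -/
def gauss {n : ℕ} (t : EuclideanSpace ℝ (Fin n)) : ℂ := Complex.ofReal (Real.exp (-‖t‖ ^ 2))

/-- The `L^p` norm (valued in `ℝ≥0∞`) of an `ℝ≥0∞`-valued function. -/
def lpN {n : ℕ} (p : ℝ≥0∞) (F : EuclideanSpace ℝ (Fin n) → ℝ≥0∞) : ℝ≥0∞ :=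
  if p = ∞ then essSup F volume
  else (∫⁻ x, F x ^ p.toReal) ^ p.toReal⁻¹

/-- The Wiener amalgam space norm `‖f‖_{W^s_{p,q}}`:
inner `L^q` norm in the frequency variable ξ, outer `L^p` norm in the space variable x,
with the Gaussian window. -/
def WNorm {n : ℕ} (s : ℝ) (p q : ℝ≥0∞) (f : EuclideanSpace ℝ (Fin n) → ℂ) : ℝ≥0∞ :=
  lpN p (fun x => lpN q (fun ξ => ENNReal.ofReal (jp s ξ) * (‖STFT gauss f x ξ‖₊ : ℝ≥0∞)))

/-- The modulation space norm `‖f‖_{M^s_{p,q}}`: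
inner `L^p` norm in the space variable x, outer `L^q` norm in the frequency variable ξ,
with the Gaussian window. -/
def MNorm {n : ℕ} (s : ℝ) (p q : ℝ≥0∞) (f : EuclideanSpace ℝ (Fin n) → ℂ) : ℝ≥0∞ :=
  lpN q (fun ξ => lpN p (fun x => ENNReal.ofReal (jp s ξ) * (‖STFT gauss f x ξ‖₊ : ℝ≥0∞)))

/-- The Schrödinger operator `e^{iεΔ} f = ℱ⁻¹ [ξ ↦ e^{-iε|ξ|²} f̂ (ξ)]` (`ε = ±1`). -/
def schrod {n : ℕ} (ε : ℝ) (f : EuclideanSpace ℝ (Fin n) → ℂ)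
    (x : EuclideanSpace ℝ (Fin n)) : ℂ :=
  (((2 * Real.pi) ^ n)⁻¹ : ℝ) *
    ∫ ξ : EuclideanSpace ℝ (Fin n),
      Complex.exp (Complex.I * Complex.ofReal ⟪x, ξ⟫) *
        Complex.exp (-(Complex.ofReal ε * Complex.I * Complex.ofReal (‖ξ‖ ^ 2))) * FT f ξ

/-- The lattice point `k ∈ ℤⁿ` viewed as a point of `ℝⁿ`. -/
def zlift {n : ℕ} (k : Fin n → ℤ) : EuclideanSpace ℝ (Fin n) :=
  (WithLp.equiv 2 (Fin n → ℝ)).symm fun i => (k i : ℝ)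


section GaussianIdentities

variable {n : ℕ}

local notation "𝔼" => EuclideanSpace ℝ (Fin n)

lemma integrable_modulated_gaussian {β : ℂ} (hβ : 0 < β.re) (w c : 𝔼) :
    Integrable fun t : 𝔼 => Complex.exp (Complex.I * (⟪w, t⟫ : ℝ)) *
      Complex.exp (-β * (‖t - c‖ ^ 2 : ℝ)) := by
  have h := ((GaussianFourier.integrable_cexp_neg_mul_sq_norm_add hβ Complex.I w).const_mul
    (Complex.exp (Complex.I * (⟪w, c⟫ : ℝ)))).comp_sub_right c
  refine h.congr (Filter.Eventually.of_forall fun t => ?_)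
  simp only [← Complex.exp_add, inner_sub_right]
  congr 1
  push_cast
  ring

lemma integral_modulated_gaussian {β : ℂ} (hβ : 0 < β.re) (w c : 𝔼) :
    ∫ t : 𝔼, Complex.exp (Complex.I * (⟪w, t⟫ : ℝ)) * Complex.exp (-β * (‖t - c‖ ^ 2 : ℝ)) =
      (π / β : ℂ) ^ (n / 2 : ℂ) *
        (Complex.exp (Complex.I * (⟪w, c⟫ : ℝ)) *
          Complex.exp (-(‖w‖ ^ 2 : ℝ) / (4 * β))) := by
  have h := GaussianFourier.integral_cexp_neg_mul_sq_norm_add hβ Complex.I w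
  rw [← integral_sub_right_eq_self _ c] at h
  have h2 : ∀ t : 𝔼, Complex.exp (Complex.I * (⟪w, t⟫ : ℝ)) *
      Complex.exp (-β * (‖t - c‖ ^ 2 : ℝ)) = Complex.exp (Complex.I * (⟪w, c⟫ : ℝ)) *
        Complex.exp (-β * ‖t - c‖ ^ 2 + Complex.I * (⟪w, t - c⟫ : ℝ)) := fun t => by
    simp only [← Complex.exp_add, inner_sub_right]
    congr 1
    push_cast
    ring
  simp_rw [h2]
  rw [integral_const_mul, h, Complex.I_sq]
  simp only [finrank_euclideanSpace, Fintype.card_fin]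
  push_cast
  ring_nf

/-- Integrating a Fourier integral against a modulated Gaussian. -/
lemma integral_gaussian_mul_fourier {β : ℂ} (hβ : 0 < β.re) (σ : ℝ) (w c : 𝔼) {h : 𝔼 → ℂ}
    (hh : Integrable h) :
    ∫ t : 𝔼, Complex.exp (Complex.I * (⟪w, t⟫ : ℝ)) * Complex.exp (-β * (‖t - c‖ ^ 2 : ℝ)) *
        ∫ ζ : 𝔼, Complex.exp (Complex.I * (σ * ⟪t, ζ⟫ : ℝ)) * h ζ =
      (π / β : ℂ) ^ (n / 2 : ℂ) *
        ∫ ζ : 𝔼, Complex.exp (Complex.I * (⟪w + σ • ζ, c⟫ : ℝ)) *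
          Complex.exp (-(‖w + σ • ζ‖ ^ 2 : ℝ) / (4 * β)) * h ζ := by
  simp_rw [← integral_const_mul]
  rw [integral_integral_swap]
  · refine integral_congr_ae (Filter.Eventually.of_forall fun ζ => ?_)
    simp only
    rw [← mul_assoc, ← integral_modulated_gaussian hβ, ← integral_mul_const]
    refine integral_congr_ae (Filter.Eventually.of_forall fun t => ?_)
    simp only [inner_add_left, inner_smul_left, real_inner_comm t ζ]
    push_cast
    simp only [mul_add, Complex.exp_add, RCLike.conj_to_real]
    ring
  · have h1 := (integrable_modulated_gaussian hβ w c).mul_prod hh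
    have h2 := h1.bdd_mul (c := 1)
      (f := fun z : 𝔼 × 𝔼 => Complex.exp (Complex.I * (σ * ⟪z.1, z.2⟫ : ℝ)))
      (by
        refine Continuous.aestronglyMeasurable ?_
        fun_prop)
      (Filter.Eventually.of_forall fun z => by
        rw [mul_comm, Complex.norm_exp_ofReal_mul_I])
    refine h2.congr (Filter.Eventually.of_forall fun z => ?_)
    simp only [Function.uncurry]
    ring

lemma integrable_FT (f : SchwartzMap 𝔼 ℂ) : Integrable (FT (⇑f)) := by
  have h := (FourierTransform.fourier f).integrable (μ := volume)
  rw [← integrable_comp_smul_iff volume _ (R := (2 * π)⁻¹) (by positivity)] at h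
  refine h.congr (Filter.Eventually.of_forall fun ξ => ?_)
  simp only [SchwartzMap.fourier_coe, Real.fourier_eq', FT, smul_eq_mul]
  refine integral_congr_ae (Filter.Eventually.of_forall fun x => ?_)
  simp only [inner_smul_right, real_inner_comm x ξ]
  congr 2
  push_cast
  field_simp

lemma gauss_sub_conj (t x : 𝔼) :
    (starRingEnd ℂ) (gauss (t - x)) = Complex.exp (-1 * (‖t - x‖ ^ 2 : ℝ)) := by
  rw [gauss, Complex.conj_ofReal, Complex.ofReal_exp]
  simp

/-- The short-time Fourier transform with a Gaussian window, read on the frequency side. -/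
lemma fourier_gaussian_window {f : 𝔼 → ℂ} (hf : Integrable f) (y η : 𝔼) :
    ∫ ζ : 𝔼, Complex.exp (Complex.I * (⟪y, ζ⟫ : ℝ)) *
        Complex.exp (-(1 / 4) * (‖ζ - η‖ ^ 2 : ℝ)) * FT f ζ =
      (4 * π : ℂ) ^ (n / 2 : ℂ) * (Complex.exp (Complex.I * (⟪y, η⟫ : ℝ)) *
        STFT gauss f y η) := by
  have h := integral_gaussian_mul_fourier (β := 1 / 4) (by norm_num) (-1) y η hf
  have h1 : ∀ ζ : 𝔼, FT f ζ = ∫ t, Complex.exp (Complex.I * (-1 * ⟪ζ, t⟫ : ℝ)) * f t := by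
    intro ζ
    simp [FT]
  simp_rw [h1]
  rw [h, STFT]
  congr 1
  · ring_nf
  · rw [← integral_const_mul]
    refine integral_congr_ae (Filter.Eventually.of_forall fun t => ?_)
    simp only [gauss_sub_conj, ← mul_assoc]
    congr 1
    simp only [neg_smul, one_smul, ← sub_eq_add_neg, ← Complex.exp_add, inner_sub_left,
      norm_sub_rev y t, real_inner_comm t η]
    congr 1
    push_cast
    ring

lemma stft_schrod {f : 𝔼 → ℂ} (hf : Integrable (FT f)) (x ξ : 𝔼) :
    STFT gauss (schrod 1 f) x ξ = (((2 * π) ^ n)⁻¹ : ℝ) * (π : ℂ) ^ (n / 2 : ℂ) *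
      Complex.exp (-(Complex.I * (⟪ξ, x⟫ : ℝ))) *
      ∫ ζ : 𝔼, Complex.exp (Complex.I * (⟪x, ζ⟫ : ℝ)) *
        Complex.exp (-Complex.I * (‖ζ‖ ^ 2 : ℝ)) *
        Complex.exp (-(1 / 4) * (‖ζ - ξ‖ ^ 2 : ℝ)) * FT f ζ := by
  have hi : Integrable fun ζ => Complex.exp (-Complex.I * (‖ζ‖ ^ 2 : ℝ)) * FT f ζ := by
    refine hf.bdd_mul (c := 1) (Continuous.aestronglyMeasurable (by fun_prop))
      (Filter.Eventually.of_forall fun ζ => ?_)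
    rw [neg_mul, ← mul_neg, mul_comm, ← Complex.ofReal_neg, Complex.norm_exp_ofReal_mul_I]
  have h := integral_gaussian_mul_fourier (β := 1) (by norm_num) 1 (-ξ) x hi
  have h1 : STFT gauss (schrod 1 f) x ξ = (((2 * π) ^ n)⁻¹ : ℝ) *
      ∫ t : 𝔼, Complex.exp (Complex.I * (⟪-ξ, t⟫ : ℝ)) *
        Complex.exp (-1 * (‖t - x‖ ^ 2 : ℝ)) *
        ∫ ζ : 𝔼, Complex.exp (Complex.I * (1 * ⟪t, ζ⟫ : ℝ)) *
          (Complex.exp (-Complex.I * (‖ζ‖ ^ 2 : ℝ)) * FT f ζ) := by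
    rw [STFT, ← integral_const_mul]
    refine integral_congr_ae (Filter.Eventually.of_forall fun t => ?_)
    simp only [schrod, gauss_sub_conj, inner_neg_left, one_mul, Complex.ofReal_neg, mul_neg,
      Complex.ofReal_one, neg_mul, mul_assoc]
    ring
  rw [h1, h, div_one, mul_assoc, mul_assoc]
  congr 2
  rw [← integral_const_mul]
  refine integral_congr_ae (Filter.Eventually.of_forall fun ζ => ?_)
  simp only [← mul_assoc]
  congr 1
  simp only [one_smul, ← Complex.exp_add, inner_add_left, inner_neg_left, real_inner_comm x ζ]
  rw [neg_add_eq_sub ξ ζ]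
  congr 1
  push_cast
  ring

lemma norm_sq_midpoint_identity (ζ ξ η : 𝔼) :
    ‖ζ - ξ‖ ^ 2 + ‖ζ - η‖ ^ 2 =
      2 * ‖ζ - (2⁻¹ : ℝ) • (ξ + η)‖ ^ 2 + 2⁻¹ * ‖ξ - η‖ ^ 2 := by
  simp only [norm_sub_sq_real, norm_smul, inner_smul_right, inner_add_right, mul_pow,
    norm_add_sq_real, norm_inv, Real.norm_ofNat]
  ring

end GaussianIdentities

/-- The Gaussian `e^{-c|v|²}` with values in `ℝ≥0∞`. -/
def gaussKernel {n : ℕ} (c : ℝ) (v : EuclideanSpace ℝ (Fin n)) : ℝ≥0∞ :=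
  ENNReal.ofReal (Real.exp (-c * ‖v‖ ^ 2))

section KernelBound

variable {n : ℕ}

local notation "𝔼" => EuclideanSpace ℝ (Fin n)

lemma enorm_cexp (z : ℂ) : ‖Complex.exp z‖ₑ = ENNReal.ofReal (Real.exp z.re) := by
  rw [← ofReal_norm, Complex.norm_exp]

lemma gaussian_phase_identity (x ξ η ζ : 𝔼) :
    Complex.exp (Complex.I * (⟪x, ζ⟫ : ℝ)) * Complex.exp (-Complex.I * (‖ζ‖ ^ 2 : ℝ)) *
        Complex.exp (-(1 / 4) * (‖ζ - ξ‖ ^ 2 : ℝ)) *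
        (Complex.exp (-(1 / 2) * (‖ζ - η‖ ^ 2 : ℝ))) =
      Complex.exp (-(1 / 8) * (‖ξ - η‖ ^ 2 : ℝ) +
          Complex.I * (2⁻¹ * ⟪x, ξ + η⟫ - 4⁻¹ * ‖ξ + η‖ ^ 2 : ℝ)) *
        (Complex.exp (Complex.I *
            (⟪-((2⁻¹ : ℝ) • (ξ + η)) + (1 : ℝ) • ζ, x - (ξ + η)⟫ : ℝ)) *
          Complex.exp (-(‖-((2⁻¹ : ℝ) • (ξ + η)) + (1 : ℝ) • ζ‖ ^ 2 : ℝ) /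
            (4 * (1 / (2 + 4 * Complex.I)))) *
          Complex.exp (-(1 / 4) * (‖ζ - η‖ ^ 2 : ℝ))) := by
  have h1 := norm_sq_midpoint_identity ζ ξ η
  have h2 : ‖-((2⁻¹ : ℝ) • (ξ + η)) + (1 : ℝ) • ζ‖ ^ 2 =
      2⁻¹ * ‖ζ - ξ‖ ^ 2 + 2⁻¹ * ‖ζ - η‖ ^ 2 - 4⁻¹ * ‖ξ - η‖ ^ 2 := by
    rw [one_smul, neg_add_eq_sub]
    linarith
  have h3 : ‖-((2⁻¹ : ℝ) • (ξ + η)) + (1 : ℝ) • ζ‖ ^ 2 =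
      ‖ζ‖ ^ 2 - ⟪ζ, ξ + η⟫ + 4⁻¹ * ‖ξ + η‖ ^ 2 := by
    rw [one_smul, neg_add_eq_sub, norm_sub_sq_real, inner_smul_right, norm_smul, mul_pow]
    norm_num
    ring
  have h4 : ⟪-((2⁻¹ : ℝ) • (ξ + η)) + (1 : ℝ) • ζ, x - (ξ + η)⟫ =
      ⟪x, ζ⟫ - ⟪ζ, ξ + η⟫ - 2⁻¹ * ⟪x, ξ + η⟫ + 2⁻¹ * ‖ξ + η‖ ^ 2 := by
    rw [one_smul, neg_add_eq_sub, inner_sub_left, inner_sub_right, inner_sub_right,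
      inner_smul_left, inner_smul_left, real_inner_self_eq_norm_sq, real_inner_comm x ζ,
      real_inner_comm x (ξ + η)]
    simp
    ring
  have h5 : ∀ r : ℝ, -(r : ℂ) / (4 * (1 / (2 + 4 * Complex.I))) =
      -(1 / 2) * r - Complex.I * r := by
    intro r
    have : (2 + 4 * Complex.I) ≠ 0 := fun h => by simpa using congrArg Complex.re h
    field_simp
    ring
  rw [h5]
  simp only [← Complex.exp_add]
  congr 1
  nth_rewrite 2 [h3]
  rw [h2, h4]
  push_cast
  ring

lemma enorm_localized_integral_le : ∃ C : ℝ≥0∞, C ≠ ∞ ∧ ∀ f : SchwartzMap 𝔼 ℂ, ∀ x ξ η : 𝔼,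
    ‖∫ ζ : 𝔼, Complex.exp (Complex.I * (⟪x, ζ⟫ : ℝ)) *
        Complex.exp (-Complex.I * (‖ζ‖ ^ 2 : ℝ)) *
        Complex.exp (-(1 / 4) * (‖ζ - ξ‖ ^ 2 : ℝ)) *
        Complex.exp (-(1 / 2) * (‖ζ - η‖ ^ 2 : ℝ)) * FT f ζ‖ₑ ≤
      C * (gaussKernel (1 / 8) (ξ - η) *
        ∫⁻ y : 𝔼, gaussKernel (1 / 10) (x - y - ξ - η) * ‖STFT gauss f y η‖ₑ) := by
  have hb : 0 < (1 / (2 + 4 * Complex.I)).re := by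
    simp [Complex.inv_re, Complex.normSq_apply]
    norm_num
  have hbre : (1 / (2 + 4 * Complex.I)).re = 1 / 10 := by
    simp [Complex.inv_re, Complex.normSq_apply]
    norm_num
  set b : ℂ := 1 / (2 + 4 * Complex.I) with hbdef
  have hb0 : b ≠ 0 := fun h => by simp [h] at hb
  have hA : (π / b : ℂ) ^ (n / 2 : ℂ) ≠ 0 := by
    rw [Complex.cpow_def_of_ne_zero (by simp [hb0, Real.pi_ne_zero])]
    exact Complex.exp_ne_zero _
  refine ⟨‖((π / b : ℂ) ^ (n / 2 : ℂ))⁻¹‖ₑ * ‖(4 * π : ℂ) ^ (n / 2 : ℂ)‖ₑ,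
    ENNReal.mul_ne_top enorm_ne_top enorm_ne_top, fun f x ξ η => ?_⟩
  have hi : Integrable fun ζ => Complex.exp (-(1 / 4) * (‖ζ - η‖ ^ 2 : ℝ)) * FT f ζ := by
    refine (integrable_FT f).bdd_mul (c := 1) (Continuous.aestronglyMeasurable (by fun_prop))
      (Filter.Eventually.of_forall fun ζ => ?_)
    rw [Complex.norm_exp, Real.exp_le_one_iff]
    norm_num [-Complex.ofReal_pow]
  have h := integral_gaussian_mul_fourier hb 1 (-((2⁻¹ : ℝ) • (ξ + η))) (x - (ξ + η)) hi
  set P : ℂ := Complex.exp (-(1 / 8) * (‖ξ - η‖ ^ 2 : ℝ) +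
          Complex.I * (2⁻¹ * ⟪x, ξ + η⟫ - 4⁻¹ * ‖ξ + η‖ ^ 2 : ℝ)) with hP
  have hPn : ‖P‖ₑ = gaussKernel (1 / 8) (ξ - η) := by
    rw [hP, enorm_cexp, gaussKernel]
    norm_num [-Complex.ofReal_pow]
  have hW : ∀ y : 𝔼, ‖∫ ζ : 𝔼, Complex.exp (Complex.I * (1 * ⟪y, ζ⟫ : ℝ)) *
      (Complex.exp (-(1 / 4) * (‖ζ - η‖ ^ 2 : ℝ)) * FT f ζ)‖ₑ =
      ‖(4 * π : ℂ) ^ (n / 2 : ℂ)‖ₑ * ‖STFT gauss f y η‖ₑ := by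
    intro y
    simp_rw [one_mul, ← mul_assoc]
    rw [fourier_gaussian_window f.integrable, enorm_mul, enorm_mul, enorm_cexp]
    norm_num
  have h2 : ∫ ζ : 𝔼, Complex.exp (Complex.I * (⟪x, ζ⟫ : ℝ)) *
        Complex.exp (-Complex.I * (‖ζ‖ ^ 2 : ℝ)) *
        Complex.exp (-(1 / 4) * (‖ζ - ξ‖ ^ 2 : ℝ)) *
        Complex.exp (-(1 / 2) * (‖ζ - η‖ ^ 2 : ℝ)) * FT f ζ =
      P * (((π / b : ℂ) ^ (n / 2 : ℂ))⁻¹ * ((π / b : ℂ) ^ (n / 2 : ℂ) *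
        ∫ ζ : 𝔼, Complex.exp (Complex.I *
            (⟪-((2⁻¹ : ℝ) • (ξ + η)) + (1 : ℝ) • ζ, x - (ξ + η)⟫ : ℝ)) *
          Complex.exp (-(‖-((2⁻¹ : ℝ) • (ξ + η)) + (1 : ℝ) • ζ‖ ^ 2 : ℝ) / (4 * b)) *
          (Complex.exp (-(1 / 4) * (‖ζ - η‖ ^ 2 : ℝ)) * FT f ζ))) := by
    rw [inv_mul_cancel_left₀ hA, ← integral_const_mul]
    refine integral_congr_ae (Filter.Eventually.of_forall fun ζ => ?_)
    simp only [gaussian_phase_identity, hP]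
    ring
  rw [h2, ← h, enorm_mul, enorm_mul, hPn]
  calc gaussKernel (1 / 8) (ξ - η) * (‖((π / b : ℂ) ^ (n / 2 : ℂ))⁻¹‖ₑ * _)
      ≤ gaussKernel (1 / 8) (ξ - η) * (‖((π / b : ℂ) ^ (n / 2 : ℂ))⁻¹‖ₑ *
        ∫⁻ y : 𝔼, ‖(4 * π : ℂ) ^ (n / 2 : ℂ)‖ₑ *
          (gaussKernel (1 / 10) (x - y - ξ - η) * ‖STFT gauss f y η‖ₑ)) := by
        gcongr
        refine (enorm_integral_le_lintegral_enorm _).trans (lintegral_mono fun y => ?_)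
        rw [enorm_mul, enorm_mul, hW, enorm_cexp, enorm_cexp, gaussKernel]
        have h7 : x - y - ξ - η = -(y - (x - (ξ + η))) := by abel
        rw [h7, norm_neg]
        simp only [Complex.re_mul_ofReal, Complex.neg_re, hbre, Complex.I_re]
        simp only [zero_mul, Real.exp_zero, ENNReal.ofReal_one, one_mul]
        exact le_of_eq (by ring)
    _ = _ := by
        rw [lintegral_const_mul' _ _ enorm_ne_top]
        ring

/-- The short-time Fourier transform of `e^{iΔ} f` is controlled by a sheared Gaussian average
of the short-time Fourier transform of `f`. -/
lemma enorm_stft_schrod_le : ∃ C : ℝ≥0∞, C ≠ ∞ ∧ ∀ f : SchwartzMap 𝔼 ℂ, ∀ x ξ : 𝔼,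
    ‖STFT gauss (schrod 1 f) x ξ‖ₑ ≤ C * ∫⁻ η : 𝔼, gaussKernel (1 / 8) (ξ - η) *
        ∫⁻ y : 𝔼, gaussKernel (1 / 10) (x - y - ξ - η) * ‖STFT gauss f y η‖ₑ := by
  obtain ⟨C, hC, h⟩ := enorm_localized_integral_le (n := n)
  have hc0 : (2 * π : ℂ) ^ (n / 2 : ℂ) ≠ 0 := by
    rw [Complex.cpow_def_of_ne_zero (by simp [Real.pi_ne_zero])]
    exact Complex.exp_ne_zero _
  set D : ℂ := (((2 * π) ^ n)⁻¹ : ℝ) * (π : ℂ) ^ (n / 2 : ℂ) *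
    ((2 * π : ℂ) ^ (n / 2 : ℂ))⁻¹ with hD
  refine ⟨‖D‖ₑ * C, ENNReal.mul_ne_top enorm_ne_top hC, fun f x ξ => ?_⟩
  set F : 𝔼 → ℂ := fun ζ => Complex.exp (Complex.I * (⟪x, ζ⟫ : ℝ)) *
        Complex.exp (-Complex.I * (‖ζ‖ ^ 2 : ℝ)) *
        Complex.exp (-(1 / 4) * (‖ζ - ξ‖ ^ 2 : ℝ)) * FT f ζ with hF
  have hFi : Integrable F := by
    refine (integrable_FT f).bdd_mul (c := 1) (Continuous.aestronglyMeasurable (by fun_prop))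
      (Filter.Eventually.of_forall fun ζ => ?_)
    rw [← Complex.exp_add, ← Complex.exp_add, Complex.norm_exp, Real.exp_le_one_iff]
    norm_num [-Complex.ofReal_pow]
  have hG : ∀ ζ : 𝔼, ∫ η : 𝔼, Complex.exp (-(1 / 2) * (‖ζ - η‖ ^ 2 : ℝ)) =
      (2 * π : ℂ) ^ (n / 2 : ℂ) := by
    intro ζ
    have h8 := integral_modulated_gaussian (n := n) (β := 1 / 2) (by norm_num) 0 ζ
    simp only [inner_zero_left, Complex.ofReal_zero, mul_zero, Complex.exp_zero, one_mul,
      norm_zero] at h8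
    simp_rw [norm_sub_rev ζ]
    rw [h8]
    norm_num
    ring_nf
  have key : (2 * π : ℂ) ^ (n / 2 : ℂ) * ∫ ζ, F ζ =
      ∫ η : 𝔼, ∫ ζ : 𝔼, Complex.exp (-(1 / 2) * (‖ζ - η‖ ^ 2 : ℝ)) * F ζ := by
    rw [integral_integral_swap]
    · rw [← integral_const_mul]
      refine integral_congr_ae (Filter.Eventually.of_forall fun ζ => ?_)
      simp only
      rw [integral_mul_const, hG]
    · have hi := integrable_modulated_gaussian (n := n) (β := 1 / 2) (by norm_num) 0 0
      simp only [inner_zero_left, Complex.ofReal_zero, mul_zero, Complex.exp_zero, one_mul,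
        sub_zero] at hi
      have := (measurePreserving_sub_prod (volume : Measure 𝔼) volume).integrable_comp_of_integrable
        (hi.mul_prod hFi)
      refine this.congr (Filter.Eventually.of_forall fun z => ?_)
      simp only [Function.uncurry, Function.comp, norm_sub_rev z.1 z.2]
  rw [stft_schrod (integrable_FT f)]
  have h9 : (((2 * π) ^ n)⁻¹ : ℝ) * (π : ℂ) ^ (n / 2 : ℂ) *
      Complex.exp (-(Complex.I * (⟪ξ, x⟫ : ℝ))) * ∫ ζ, F ζ =
      D * Complex.exp (-(Complex.I * (⟪ξ, x⟫ : ℝ))) *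
        ((2 * π : ℂ) ^ (n / 2 : ℂ) * ∫ ζ, F ζ) := by
    rw [hD]
    field_simp
  have h10 : (-(Complex.I * (⟪ξ, x⟫ : ℝ))).re = 0 := by simp
  rw [h9, key, enorm_mul, enorm_mul, enorm_cexp, h10, Real.exp_zero, ENNReal.ofReal_one, mul_one,
    mul_assoc ‖D‖ₑ C, ← lintegral_const_mul' _ _ hC]
  gcongr
  refine (enorm_integral_le_lintegral_enorm _).trans (lintegral_mono fun η => ?_)
  refine le_trans (le_of_eq ?_) (h f x ξ η)
  congr 2
  ext ζ
  simp only [hF]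
  ring

end KernelBound

section LpEstimates

variable {n : ℕ}

local notation "𝔼" => EuclideanSpace ℝ (Fin n)

lemma toReal_one_le {p : ℝ≥0∞} (hp : 1 ≤ p) (hp' : p ≠ ∞) : 1 ≤ p.toReal := by
  simpa using ENNReal.toReal_mono hp' hp

lemma lpN_mono_ae {p : ℝ≥0∞} {F G : 𝔼 → ℝ≥0∞} (h : ∀ᵐ x, F x ≤ G x) : lpN p F ≤ lpN p G := by
  unfold lpN
  split_ifs
  · exact essSup_mono_ae h
  · refine ENNReal.rpow_le_rpow (lintegral_mono_ae ?_) (by positivity)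
    filter_upwards [h] with x hx
    exact ENNReal.rpow_le_rpow hx (by positivity)

lemma lpN_mono {p : ℝ≥0∞} {F G : 𝔼 → ℝ≥0∞} (h : ∀ x, F x ≤ G x) : lpN p F ≤ lpN p G :=
  lpN_mono_ae (Filter.Eventually.of_forall h)

lemma ae_le_lpN_top (F : 𝔼 → ℝ≥0∞) : ∀ᵐ x, F x ≤ lpN ∞ F := by
  rw [lpN, if_pos rfl]
  exact ENNReal.ae_le_essSup F

lemma lpN_top_le {F : 𝔼 → ℝ≥0∞} {M : ℝ≥0∞} (h : ∀ᵐ x, F x ≤ M) : lpN ∞ F ≤ M := by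
  rw [lpN, if_pos rfl]
  exact essSup_le_of_ae_le _ h

lemma lpN_const_mul {p : ℝ≥0∞} (hp : 1 ≤ p) {C : ℝ≥0∞} (hC : C ≠ ∞) (F : 𝔼 → ℝ≥0∞) :
    lpN p (fun x => C * F x) = C * lpN p F := by
  unfold lpN
  split_ifs with h
  · exact ENNReal.essSup_const_mul
  · have hp1 := toReal_one_le hp h
    have h0 : 0 ≤ p.toReal := by linarith
    simp_rw [ENNReal.mul_rpow_of_nonneg _ _ h0]
    rw [lintegral_const_mul' _ _ (ENNReal.rpow_ne_top_of_nonneg h0 hC),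
      ENNReal.mul_rpow_of_nonneg _ _ (by positivity), ENNReal.rpow_rpow_inv (by linarith)]

lemma lpN_rpow {p : ℝ≥0∞} (hp : 1 ≤ p) (hp' : p ≠ ∞) (F : 𝔼 → ℝ≥0∞) :
    lpN p F ^ p.toReal = ∫⁻ x, F x ^ p.toReal := by
  have hp1 := toReal_one_le hp hp'
  rw [lpN, if_neg hp', ENNReal.rpow_inv_rpow (by linarith)]

lemma continuous_jp (s : ℝ) : Continuous (jp s : 𝔼 → ℝ) := by
  unfold jp
  exact Continuous.rpow_const (by fun_prop) fun x => Or.inl (by positivity)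

lemma jp_pos (s : ℝ) (x : 𝔼) : 0 < jp s x := by
  unfold jp
  positivity

@[fun_prop]
lemma measurable_jp (s : ℝ) : Measurable fun x : 𝔼 => ENNReal.ofReal (jp s x) :=
  (continuous_jp s).measurable.ennreal_ofReal

lemma lintegral_jp_rpow_lt_top {t : ℝ} (ht : (n : ℝ) < t) :
    ∫⁻ x : 𝔼, ENNReal.ofReal (jp (-t) x) < ∞ := by
  have h := integrable_rpow_neg_one_add_norm_sq (E := 𝔼) (μ := volume) (r := t) (by simpa using ht)
  exact h.lintegral_lt_top

lemma ofReal_jp_rpow (s r : ℝ) (x : 𝔼) :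
    ENNReal.ofReal (jp s x) ^ r = ENNReal.ofReal (jp (s * r) x) := by
  rw [ENNReal.ofReal_rpow_of_pos (jp_pos s x), jp, jp, ← Real.rpow_mul (by positivity)]
  ring_nf

lemma ofReal_jp_neg_mul_cancel (s : ℝ) (x : 𝔼) :
    ENNReal.ofReal (jp (-s) x) * ENNReal.ofReal (jp s x) = 1 := by
  rw [← ENNReal.ofReal_mul (jp_pos _ _).le, jp, jp, ← Real.rpow_add (by positivity)]
  ring_nf
  simp

/-- Hölder's inequality with a polynomial weight lowers the exponent. -/
lemma lpN_le_lpN_jp_mul {a b : ℝ≥0∞} (ha : 1 ≤ a) (hab : a < b) {s : ℝ}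
    (hs : (n : ℝ) * (a⁻¹.toReal - b⁻¹.toReal) < s) :
    ∃ C : ℝ≥0∞, C ≠ ∞ ∧ ∀ F : 𝔼 → ℝ≥0∞, Measurable F →
      lpN a F ≤ C * lpN b (fun ξ => ENNReal.ofReal (jp s ξ) * F ξ) := by
  have ha' : a ≠ ∞ := hab.ne_top
  have ha1 := toReal_one_le ha ha'
  have ha0 : 0 < a.toReal := by linarith
  have hF : ∀ (F : 𝔼 → ℝ≥0∞) ξ,
      F ξ = ENNReal.ofReal (jp (-s) ξ) * (ENNReal.ofReal (jp s ξ) * F ξ) := fun F ξ => by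
    rw [← mul_assoc, ofReal_jp_neg_mul_cancel, one_mul]
  by_cases hb : b = ∞
  · subst hb
    have hsn : (n : ℝ) < s * a.toReal := by
      simp only [ENNReal.inv_top, ENNReal.toReal_zero, sub_zero, ENNReal.toReal_inv] at hs
      rwa [← div_eq_mul_inv, div_lt_iff₀ ha0] at hs
    refine ⟨(∫⁻ x : 𝔼, ENNReal.ofReal (jp (-(s * a.toReal)) x)) ^ a.toReal⁻¹,
      ENNReal.rpow_ne_top_of_nonneg (by positivity) (lintegral_jp_rpow_lt_top hsn).ne,
      fun F hFm => ?_⟩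
    set M := lpN ∞ (fun ξ => ENNReal.ofReal (jp s ξ) * F ξ) with hM
    have hae : ∀ᵐ ξ, ENNReal.ofReal (jp s ξ) * F ξ ≤ M := ae_le_lpN_top _
    rw [lpN, if_neg ha']
    calc (∫⁻ ξ, F ξ ^ a.toReal) ^ a.toReal⁻¹
        ≤ (∫⁻ ξ, ENNReal.ofReal (jp (-(s * a.toReal)) ξ) * M ^ a.toReal) ^ a.toReal⁻¹ := by
          refine ENNReal.rpow_le_rpow (lintegral_mono_ae ?_) (by positivity)
          filter_upwards [hae] with ξ hξ
          rw [← neg_mul, ← ofReal_jp_rpow, ← ENNReal.mul_rpow_of_nonneg _ _ ha0.le]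
          refine ENNReal.rpow_le_rpow ?_ ha0.le
          rw [hF F ξ]
          gcongr
      _ = _ := by
          rw [lintegral_mul_const _ (measurable_jp _),
            ENNReal.mul_rpow_of_nonneg _ _ (by positivity), ENNReal.rpow_rpow_inv ha0.ne']
  · have hb1 := toReal_one_le (ha.trans hab.le) hb
    have habr : a.toReal < b.toReal := (ENNReal.toReal_lt_toReal ha' hb).2 hab
    simp only [ENNReal.toReal_inv] at hs
    set d := a.toReal⁻¹ - b.toReal⁻¹ with hd
    have hd0 : 0 < d := sub_pos.2 (inv_strictAnti₀ ha0 habr)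
    have hsn : (n : ℝ) < s * d⁻¹ := by
      rwa [← div_eq_mul_inv, lt_div_iff₀ hd0]
    refine ⟨(∫⁻ x : 𝔼, ENNReal.ofReal (jp (-(s * d⁻¹)) x)) ^ (1 / d⁻¹),
      ENNReal.rpow_ne_top_of_nonneg (by positivity) (lintegral_jp_rpow_lt_top hsn).ne,
      fun F hFm => ?_⟩
    have h := ENNReal.lintegral_Lp_mul_le_Lq_mul_Lr (r := d⁻¹) ha0 habr
      (by rw [one_div d⁻¹, inv_inv, hd]; ring) (volume : Measure 𝔼)
      (f := fun ξ => ENNReal.ofReal (jp s ξ) * F ξ) (g := fun ξ => ENNReal.ofReal (jp (-s) ξ))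
      (by fun_prop) (measurable_jp _).aemeasurable
    simp only [Pi.mul_apply, ofReal_jp_rpow] at h
    rw [lpN, if_neg ha', lpN, if_neg hb, mul_comm]
    simp only [one_div, neg_mul] at h ⊢
    refine le_trans (le_of_eq ?_) h
    congr 2
    ext ξ
    congr 1
    rw [mul_comm, ← hF]

@[fun_prop]
lemma measurable_gaussKernel (c : ℝ) : Measurable (gaussKernel c : 𝔼 → ℝ≥0∞) := by
  unfold gaussKernel
  fun_prop

lemma gaussKernel_ne_top (c : ℝ) (v : 𝔼) : gaussKernel c v ≠ ∞ := ENNReal.ofReal_ne_top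

lemma gaussKernel_le_one {c : ℝ} (hc : 0 ≤ c) (v : 𝔼) : gaussKernel c v ≤ 1 := by
  rw [gaussKernel, ENNReal.ofReal_le_one, Real.exp_le_one_iff]
  have : 0 ≤ c * ‖v‖ ^ 2 := by positivity
  linarith

lemma lintegral_gaussKernel_ne_top {c : ℝ} (hc : 0 < c) :
    ∫⁻ v : 𝔼, gaussKernel c v ≠ ∞ := by
  have h := (integrable_modulated_gaussian (n := n) (β := c) (by simpa using hc) 0 0).norm
  simp only [norm_mul, Complex.norm_exp] at h
  refine ne_of_eq_of_ne (lintegral_congr fun v => ?_) h.lintegral_lt_top.ne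
  norm_num [gaussKernel, -Complex.ofReal_pow]

/-- Convolution with a Gaussian. -/
def gaussConv (c : ℝ) (h : 𝔼 → ℝ≥0∞) (ξ : 𝔼) : ℝ≥0∞ :=
  ∫⁻ η : 𝔼, gaussKernel c (ξ - η) * h η

@[fun_prop]
lemma measurable_gaussConv (c : ℝ) {h : 𝔼 → ℝ≥0∞} (hh : Measurable h) :
    Measurable (gaussConv c h) := by
  unfold gaussConv
  exact Measurable.lintegral_prod_right' (f := fun z : 𝔼 × 𝔼 => gaussKernel c (z.1 - z.2) * h z.2)
    (by fun_prop)

lemma gaussConv_rpow_le (c : ℝ) {h : 𝔼 → ℝ≥0∞} (hh : Measurable h) {p : ℝ} (hp : 1 ≤ p) (ξ : 𝔼) :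
    gaussConv c h ξ ^ p ≤
      (∫⁻ v : 𝔼, gaussKernel c v) ^ (p - 1) * gaussConv c (fun η => h η ^ p) ξ := by
  have hp0 : 0 < p := by linarith
  have hpi : p⁻¹ ≤ 1 := inv_le_one_of_one_le₀ hp
  have key := ENNReal.lintegral_mul_norm_pow_le (μ := (volume : Measure 𝔼))
    (f := fun η => gaussKernel c (ξ - η)) (g := fun η => gaussKernel c (ξ - η) * h η ^ p)
    (p := 1 - p⁻¹) (q := p⁻¹) (by fun_prop) (by fun_prop) (by linarith) (by positivity) (by ring)
  have h1 : ∀ η, gaussKernel c (ξ - η) ^ (1 - p⁻¹) * (gaussKernel c (ξ - η) * h η ^ p) ^ p⁻¹ =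
      gaussKernel c (ξ - η) * h η := fun η => by
    rw [ENNReal.mul_rpow_of_nonneg _ _ (by positivity), ENNReal.rpow_rpow_inv hp0.ne', ← mul_assoc,
      ← ENNReal.rpow_add_of_nonneg _ _ (by linarith) (by positivity)]
    simp
  simp only [h1] at key
  rw [lintegral_sub_left_eq_self (fun v => gaussKernel c v) ξ] at key
  calc gaussConv c h ξ ^ p ≤ _ := ENNReal.rpow_le_rpow key hp0.le
    _ = _ := by
      rw [ENNReal.mul_rpow_of_nonneg _ _ hp0.le, ENNReal.rpow_inv_rpow hp0.ne', ← ENNReal.rpow_mul,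
        sub_mul, one_mul, inv_mul_cancel₀ hp0.ne']
      rfl

lemma lintegral_gaussConv (c : ℝ) {h : 𝔼 → ℝ≥0∞} (hh : Measurable h) :
    ∫⁻ ξ, gaussConv c h ξ = (∫⁻ v : 𝔼, gaussKernel c v) * ∫⁻ η, h η := by
  unfold gaussConv
  rw [lintegral_lintegral_swap (by fun_prop), ← lintegral_const_mul _ hh]
  refine lintegral_congr fun η => ?_
  rw [lintegral_mul_const _ (by fun_prop), lintegral_sub_right_eq_self]

lemma lintegral_gaussConv_rpow_le (c : ℝ) {h : 𝔼 → ℝ≥0∞} (hh : Measurable h) {p : ℝ} (hp : 1 ≤ p) :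
    ∫⁻ ξ, gaussConv c h ξ ^ p ≤ (∫⁻ v : 𝔼, gaussKernel c v) ^ p * ∫⁻ η, h η ^ p := by
  calc ∫⁻ ξ, gaussConv c h ξ ^ p
      ≤ ∫⁻ ξ, (∫⁻ v : 𝔼, gaussKernel c v) ^ (p - 1) * gaussConv c (fun η => h η ^ p) ξ :=
        lintegral_mono fun ξ => gaussConv_rpow_le c hh hp ξ
    _ = (∫⁻ v : 𝔼, gaussKernel c v) ^ (p - 1) *
        ((∫⁻ v : 𝔼, gaussKernel c v) ^ (1 : ℝ) * ∫⁻ η, h η ^ p) := by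
        rw [lintegral_const_mul _ (measurable_gaussConv c (by fun_prop)),
          lintegral_gaussConv c (by fun_prop), ENNReal.rpow_one]
    _ = _ := by
        rw [← mul_assoc, ← ENNReal.rpow_add_of_nonneg _ _ (by linarith) (by positivity)]
        ring_nf

/-- Convolution with a Gaussian raises the exponent. -/
lemma lpN_gaussConv_le {c : ℝ} (hc : 0 < c) {a b : ℝ≥0∞} (ha : 1 ≤ a) (ha' : a ≠ ∞) (hab : a ≤ b) :
    ∃ C : ℝ≥0∞, C ≠ ∞ ∧ ∀ h : 𝔼 → ℝ≥0∞, Measurable h →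
      lpN b (gaussConv c h) ≤ C * lpN a h := by
  have ha1 := toReal_one_le ha ha'
  have ha0 : 0 < a.toReal := by linarith
  set K := ∫⁻ v : 𝔼, gaussKernel c v with hK
  have hKt : K ≠ ∞ := lintegral_gaussKernel_ne_top hc
  set L := (K ^ (a.toReal - 1)) ^ a.toReal⁻¹ with hL
  have hLt : L ≠ ∞ := ENNReal.rpow_ne_top_of_nonneg (by positivity)
    (ENNReal.rpow_ne_top_of_nonneg (by linarith) hKt)
  have hsup : ∀ h : 𝔼 → ℝ≥0∞, Measurable h → ∀ ξ, gaussConv c h ξ ≤ L * lpN a h := by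
    intro h hh ξ
    rw [← ENNReal.rpow_le_rpow_iff ha0]
    refine (gaussConv_rpow_le c hh ha1 ξ).trans ?_
    rw [ENNReal.mul_rpow_of_nonneg _ _ ha0.le, hL, ENNReal.rpow_inv_rpow ha0.ne',
      lpN_rpow ha ha']
    gcongr
    refine lintegral_mono fun η => ?_
    exact mul_le_of_le_one_left zero_le (gaussKernel_le_one hc.le _)
  by_cases hb : b = ∞
  · subst hb
    exact ⟨L, hLt, fun h hh => lpN_top_le (Filter.Eventually.of_forall (hsup h hh))⟩
  · have hb0 : 0 < b.toReal := by
      have := toReal_one_le (ha.trans hab) hb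
      linarith
    have habr : a.toReal ≤ b.toReal := ENNReal.toReal_mono hb hab
    refine ⟨(L ^ (b.toReal - a.toReal) * K ^ a.toReal) ^ b.toReal⁻¹,
      ENNReal.rpow_ne_top_of_nonneg (by positivity) (ENNReal.mul_ne_top
        (ENNReal.rpow_ne_top_of_nonneg (by linarith) hLt)
        (ENNReal.rpow_ne_top_of_nonneg ha0.le hKt)), fun h hh => ?_⟩
    rw [← ENNReal.rpow_le_rpow_iff hb0, lpN_rpow (ha.trans hab) hb,
      ENNReal.mul_rpow_of_nonneg _ _ hb0.le, ENNReal.rpow_inv_rpow hb0.ne']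
    have hsplit : ∀ y : ℝ≥0∞, y ^ b.toReal = y ^ (b.toReal - a.toReal) * y ^ a.toReal := by
      intro y
      rw [← ENNReal.rpow_add_of_nonneg _ _ (by linarith) ha0.le]
      ring_nf
    calc ∫⁻ ξ, gaussConv c h ξ ^ b.toReal
        ≤ ∫⁻ ξ, (L * lpN a h) ^ (b.toReal - a.toReal) * gaussConv c h ξ ^ a.toReal := by
          refine lintegral_mono fun ξ => ?_
          rw [hsplit]
          gcongr
          exact hsup h hh ξ
      _ = (L * lpN a h) ^ (b.toReal - a.toReal) * ∫⁻ ξ, gaussConv c h ξ ^ a.toReal :=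
          lintegral_const_mul _ (by fun_prop)
      _ ≤ (L * lpN a h) ^ (b.toReal - a.toReal) * (K ^ a.toReal * lpN a h ^ a.toReal) := by
          rw [lpN_rpow ha ha']
          gcongr
          exact lintegral_gaussConv_rpow_le c hh ha1
      _ = _ := by
          rw [hsplit (lpN a h), ENNReal.mul_rpow_of_nonneg _ _ (by linarith)]
          ring

/-- Sheared convolution with a Gaussian is bounded on `L^p` of the phase space. -/
lemma lpN_lpN_sheared_gaussConv_le {c : ℝ} (hc : 0 < c) {p : ℝ≥0∞} (hp : 1 ≤ p) :
    ∃ C : ℝ≥0∞, C ≠ ∞ ∧ ∀ Φ : 𝔼 → 𝔼 → ℝ≥0∞, Measurable (Function.uncurry Φ) →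
      lpN p (fun x : 𝔼 => lpN p fun ξ : 𝔼 => gaussConv c (fun y => Φ y ξ) (x - (2 : ℝ) • ξ)) ≤
        C * lpN p (fun y : 𝔼 => lpN p (Φ y)) := by
  set K := ∫⁻ v : 𝔼, gaussKernel c v with hK
  have hKt : K ≠ ∞ := lintegral_gaussKernel_ne_top hc
  refine ⟨K, hKt, fun Φ hΦ => ?_⟩
  by_cases hp' : p = ∞
  · subst hp'
    set M := lpN ∞ (fun y : 𝔼 => lpN ∞ (Φ y)) with hM
    have h1 : ∀ᵐ y : 𝔼, ∀ᵐ ξ : 𝔼, Φ y ξ ≤ M := by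
      filter_upwards [ae_le_lpN_top fun y : 𝔼 => lpN ∞ (Φ y)] with y hy
      filter_upwards [ae_le_lpN_top (Φ y)] with ξ hξ using hξ.trans hy
    rw [Measure.ae_ae_comm (p := fun y ξ => Φ y ξ ≤ M)
      (measurableSet_le hΦ measurable_const)] at h1
    refine lpN_top_le (Filter.Eventually.of_forall fun x => lpN_top_le ?_)
    filter_upwards [h1] with ξ hξ
    calc gaussConv c (fun y => Φ y ξ) (x - (2 : ℝ) • ξ)
        ≤ ∫⁻ y : 𝔼, gaussKernel c (x - (2 : ℝ) • ξ - y) * M := by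
          refine lintegral_mono_ae ?_
          filter_upwards [hξ] with y hy
          gcongr
      _ = K * M := by
          rw [lintegral_mul_const _ (by fun_prop), lintegral_sub_left_eq_self]
  · have hp1 := toReal_one_le hp hp'
    have hp0 : 0 < p.toReal := by linarith
    rw [← ENNReal.rpow_le_rpow_iff hp0, ENNReal.mul_rpow_of_nonneg _ _ hp0.le, lpN_rpow hp hp',
      lpN_rpow hp hp']
    simp_rw [lpN_rpow hp hp']
    have hm : Measurable fun z : 𝔼 × 𝔼 =>
        gaussConv c (fun y => Φ y z.2) (z.1 - (2 : ℝ) • z.2) := by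
      unfold gaussConv
      exact Measurable.lintegral_prod_right' (f := fun w : (𝔼 × 𝔼) × 𝔼 =>
        gaussKernel c (w.1.1 - (2 : ℝ) • w.1.2 - w.2) * Function.uncurry Φ (w.2, w.1.2))
        (by fun_prop)
    have hΦs : ∀ ξ, Measurable fun y => Φ y ξ := fun ξ => 
      hΦ.comp (measurable_id.prodMk measurable_const)
    rw [lintegral_lintegral_swap (hm.pow_const _).aemeasurable,
      lintegral_lintegral_swap (f := fun y ξ => Φ y ξ ^ p.toReal) (hΦ.pow_const _).aemeasurable,
      ← lintegral_const_mul' _ _ (ENNReal.rpow_ne_top_of_nonneg hp0.le hKt)]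
    refine lintegral_mono fun ξ => ?_
    simp only
    rw [lintegral_sub_right_eq_self
      (fun x => gaussConv c (fun y => Φ y ξ) x ^ p.toReal) ((2 : ℝ) • ξ)]
    exact lintegral_gaussConv_rpow_le c (hΦs ξ) hp1

end LpEstimates

section Boundedness

variable {n : ℕ}

local notation "𝔼" => EuclideanSpace ℝ (Fin n)

lemma norm_sq_le_two_mul (a d : 𝔼) : ‖a‖ ^ 2 ≤ 2 * ‖a - d‖ ^ 2 + 2 * ‖d‖ ^ 2 := by
  have h : ‖a‖ ≤ ‖a - d‖ + ‖d‖ := by simpa using norm_add_le (a - d) d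
  nlinarith [norm_nonneg a, sq_nonneg (‖a - d‖ - ‖d‖), norm_nonneg (a - d), norm_nonneg d]

lemma gaussKernel_mul_shift_le (a d v : 𝔼) (hv : ‖v‖ = ‖d‖) :
    gaussKernel (1 / 8) v * gaussKernel (1 / 10) (a - d) ≤
      gaussKernel (1 / 40) v * gaussKernel (1 / 20) a := by
  simp only [gaussKernel]
  rw [← ENNReal.ofReal_mul (Real.exp_pos _).le, ← ENNReal.ofReal_mul (Real.exp_pos _).le,
    ← Real.exp_add, ← Real.exp_add, hv]
  refine ENNReal.ofReal_le_ofReal (Real.exp_le_exp.2 ?_)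
  linarith [norm_sq_le_two_mul a d]

lemma jp_le_exp {s : ℝ} (hs : 0 ≤ s) {c : ℝ} (hc : 0 < c) :
    ∃ C : ℝ, 0 < C ∧ ∀ v : 𝔼, jp s v ≤ C * Real.exp (c * ‖v‖ ^ 2) := by
  set ε := c / (c + s) with hε
  have hε0 : 0 < ε := by positivity
  have hε1 : ε ≤ 1 := (div_le_one (by positivity)).2 (by linarith)
  refine ⟨ε⁻¹ ^ (s / 2), by positivity, fun v => ?_⟩
  have h1 : 1 + ‖v‖ ^ 2 ≤ ε⁻¹ * Real.exp (ε * ‖v‖ ^ 2) := by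
    rw [inv_mul_eq_div, le_div_iff₀ hε0]
    nlinarith [Real.add_one_le_exp (ε * ‖v‖ ^ 2)]
  have h2 : ε * (s / 2) ≤ c := by
    rw [hε, div_mul_eq_mul_div, div_le_iff₀ (by positivity)]
    nlinarith
  calc jp s v ≤ (ε⁻¹ * Real.exp (ε * ‖v‖ ^ 2)) ^ (s / 2) :=
        Real.rpow_le_rpow (by positivity) h1 (by positivity)
    _ = ε⁻¹ ^ (s / 2) * Real.exp (ε * (s / 2) * ‖v‖ ^ 2) := by
        rw [Real.mul_rpow (by positivity) (Real.exp_pos _).le, ← Real.exp_mul]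
        ring_nf
    _ ≤ _ := by gcongr

/-- Peetre's inequality. -/
lemma jp_le_mul_jp {s : ℝ} (hs : 0 ≤ s) (ξ η : 𝔼) :
    jp s ξ ≤ 2 ^ (s / 2) * jp s (ξ - η) * jp s η := by
  unfold jp
  rw [← Real.mul_rpow (by positivity) (by positivity),
    ← Real.mul_rpow (by positivity) (by positivity)]
  refine Real.rpow_le_rpow (by positivity) ?_ (by positivity)
  have h := norm_sq_le_two_mul ξ η
  nlinarith [mul_nonneg (sq_nonneg ‖ξ - η‖) (sq_nonneg ‖η‖)]

lemma jp_mul_gaussConv_le {s : ℝ} (hs : 0 ≤ s) : ∃ C : ℝ≥0∞, C ≠ ∞ ∧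
    ∀ (h : 𝔼 → ℝ≥0∞) (ξ : 𝔼), ENNReal.ofReal (jp s ξ) * gaussConv (1 / 40) h ξ ≤
      C * gaussConv (1 / 80) (fun η => ENNReal.ofReal (jp s η) * h η) ξ := by
  obtain ⟨C, hC, hCj⟩ := jp_le_exp (n := n) hs (c := 1 / 80) (by norm_num)
  refine ⟨ENNReal.ofReal (2 ^ (s / 2) * C), ENNReal.ofReal_ne_top, fun h ξ => ?_⟩
  unfold gaussConv
  rw [← lintegral_const_mul' _ _ ENNReal.ofReal_ne_top,
    ← lintegral_const_mul' _ _ ENNReal.ofReal_ne_top]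
  refine lintegral_mono fun η => ?_
  simp only [← mul_assoc]
  refine mul_le_mul' ?_ le_rfl
  unfold gaussKernel
  rw [← ENNReal.ofReal_mul (jp_pos _ _).le, ← ENNReal.ofReal_mul (by positivity),
    ← ENNReal.ofReal_mul (by positivity)]
  refine ENNReal.ofReal_le_ofReal ?_
  have hη := (jp_pos s η).le
  calc jp s ξ * Real.exp (-(1 / 40) * ‖ξ - η‖ ^ 2)
      ≤ (2 ^ (s / 2) * (C * Real.exp (1 / 80 * ‖ξ - η‖ ^ 2)) * jp s η) *
          Real.exp (-(1 / 40) * ‖ξ - η‖ ^ 2) := by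
        gcongr
        refine (jp_le_mul_jp hs ξ η).trans ?_
        gcongr
        exact hCj _
    _ = 2 ^ (s / 2) * C * (Real.exp (1 / 80 * ‖ξ - η‖ ^ 2) *
          Real.exp (-(1 / 40) * ‖ξ - η‖ ^ 2)) * jp s η := by ring
    _ = _ := by
        rw [← Real.exp_add]
        ring_nf

lemma measurable_stft_gauss {f : 𝔼 → ℂ} (hf : Continuous f) :
    Measurable (Function.uncurry fun x ξ : 𝔼 => ‖STFT gauss f x ξ‖ₑ) := by
  have h : StronglyMeasurable fun z : 𝔼 × 𝔼 => STFT gauss f z.1 z.2 := by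
    refine StronglyMeasurable.integral_prod_right (f := fun (z : 𝔼 × 𝔼) (t : 𝔼) =>
      Complex.exp (-(Complex.I * Complex.ofReal ⟪z.2, t⟫)) *
        (starRingEnd ℂ) (gauss (t - z.1)) * f t) ?_
    simp only [gauss_sub_conj]
    refine Continuous.stronglyMeasurable ?_
    unfold Function.uncurry
    fun_prop
  exact h.measurable.enorm

lemma WNorm_zero (p q : ℝ≥0∞) (f : 𝔼 → ℂ) :
    WNorm 0 p q f = lpN p fun x => lpN q fun ξ => ‖STFT gauss f x ξ‖ₑ := by
  simp [WNorm, jp, enorm_eq_nnnorm]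

lemma measurable_sheared_gaussConv (c : ℝ) {Φ : 𝔼 → 𝔼 → ℝ≥0∞}
    (hΦ : Measurable (Function.uncurry Φ)) (x : 𝔼) :
    Measurable fun ξ => gaussConv c (fun y => Φ y ξ) (x - (2 : ℝ) • ξ) := by
  unfold gaussConv
  exact Measurable.lintegral_prod_right' (f := fun w : 𝔼 × 𝔼 =>
    gaussKernel c (x - (2 : ℝ) • w.1 - w.2) * Function.uncurry Φ (w.2, w.1)) (by fun_prop)

/-- The sheared Gaussian average that controls the Schrödinger propagator on phase space. -/
def shearedAverage (F : 𝔼 → 𝔼 → ℝ≥0∞) (x ξ : 𝔼) : ℝ≥0∞ :=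
  ∫⁻ η : 𝔼, gaussKernel (1 / 8) (ξ - η) *
    ∫⁻ y : 𝔼, gaussKernel (1 / 10) (x - y - ξ - η) * F y η

lemma shearedAverage_le_gaussConv_shear (F : 𝔼 → 𝔼 → ℝ≥0∞) (x ξ : 𝔼) :
    shearedAverage F x ξ ≤ gaussConv (1 / 40) (fun η =>
      gaussConv (1 / 20) (fun y => F y η) (x - (2 : ℝ) • η)) ξ := by
  unfold shearedAverage gaussConv
  refine lintegral_mono fun η => ?_
  rw [← lintegral_const_mul' _ _ (gaussKernel_ne_top _ _),
    ← lintegral_const_mul' _ _ (gaussKernel_ne_top _ _)]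
  refine lintegral_mono fun y => ?_
  simp only [← mul_assoc]
  refine mul_le_mul' ?_ le_rfl
  have h1 : x - y - ξ - η = (x - (2 : ℝ) • η - y) - (ξ - η) := by
    rw [two_smul]
    abel
  rw [h1]
  exact gaussKernel_mul_shift_le _ _ _ rfl

lemma shearedAverage_le_shear_gaussConv {F : 𝔼 → 𝔼 → ℝ≥0∞}
    (hF : Measurable (Function.uncurry F)) (x ξ : 𝔼) :
    shearedAverage F x ξ ≤ gaussConv (1 / 20) (fun y =>
      gaussConv (1 / 40) (F y) ξ) (x - (2 : ℝ) • ξ) := by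
  have hFs : Measurable fun z : 𝔼 × 𝔼 => F z.2 z.1 := hF.comp measurable_swap
  unfold shearedAverage gaussConv
  calc ∫⁻ η : 𝔼, gaussKernel (1 / 8) (ξ - η) *
        ∫⁻ y : 𝔼, gaussKernel (1 / 10) (x - y - ξ - η) * F y η
      ≤ ∫⁻ η : 𝔼, ∫⁻ y : 𝔼, gaussKernel (1 / 20) (x - (2 : ℝ) • ξ - y) *
          (gaussKernel (1 / 40) (ξ - η) * F y η) := by
        refine lintegral_mono fun η => ?_
        rw [← lintegral_const_mul' _ _ (gaussKernel_ne_top _ _)]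
        refine lintegral_mono fun y => ?_
        rw [← mul_assoc, ← mul_assoc, mul_comm (gaussKernel (1 / 20) _)]
        refine mul_le_mul' ?_ le_rfl
        have h1 : x - y - ξ - η = (x - (2 : ℝ) • ξ - y) - (η - ξ) := by
          rw [two_smul]
          abel
        rw [h1]
        exact gaussKernel_mul_shift_le _ _ _ (norm_sub_rev _ _)
    _ = ∫⁻ y : 𝔼, ∫⁻ η : 𝔼, gaussKernel (1 / 20) (x - (2 : ℝ) • ξ - y) *
          (gaussKernel (1 / 40) (ξ - η) * F y η) := by
        refine lintegral_lintegral_swap ?_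
        unfold Function.uncurry
        fun_prop
    _ = _ := lintegral_congr fun y => lintegral_const_mul' _ _ (gaussKernel_ne_top _ _)

lemma lpN_lpN_shearedAverage_le_of_lt {s : ℝ} {p q : ℝ≥0∞} (hp : 1 ≤ p) (hpq : p < q)
    (hs : (n : ℝ) * (p⁻¹.toReal - q⁻¹.toReal) < s) :
    ∃ C : ℝ≥0∞, C ≠ ∞ ∧ ∀ F : 𝔼 → 𝔼 → ℝ≥0∞, Measurable (Function.uncurry F) →
      lpN p (fun x => lpN q (shearedAverage F x)) ≤
        C * lpN p (fun x => lpN q fun ξ => ENNReal.ofReal (jp s ξ) * F x ξ) := by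
  obtain ⟨C₁, hC₁, h₁⟩ := lpN_gaussConv_le (n := n) (c := 1 / 40) (by norm_num) hp hpq.ne_top hpq.le
  obtain ⟨C₂, hC₂, h₂⟩ := lpN_lpN_sheared_gaussConv_le (n := n) (c := 1 / 20) (by norm_num) hp
  obtain ⟨C₃, hC₃, h₃⟩ := lpN_le_lpN_jp_mul (n := n) hp hpq hs
  refine ⟨C₁ * (C₂ * C₃), ENNReal.mul_ne_top hC₁ (ENNReal.mul_ne_top hC₂ hC₃), fun F hF => ?_⟩
  have hFy : ∀ y : 𝔼, Measurable (F y) := fun y => hF.comp (measurable_prodMk_left (x := y))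
  calc lpN p (fun x => lpN q (shearedAverage F x))
      ≤ lpN p (fun x => C₁ * lpN p fun η =>
          gaussConv (1 / 20) (fun y => F y η) (x - (2 : ℝ) • η)) :=
        lpN_mono fun x => (lpN_mono (shearedAverage_le_gaussConv_shear F x)).trans
          (h₁ _ (measurable_sheared_gaussConv _ hF x))
    _ ≤ C₁ * (C₂ * lpN p (fun y => C₃ * lpN q fun ξ => ENNReal.ofReal (jp s ξ) * F y ξ)) := by
        rw [lpN_const_mul hp hC₁]
        refine mul_le_mul' le_rfl ((h₂ F hF).trans (mul_le_mul' le_rfl ?_))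
        exact lpN_mono fun y => h₃ (F y) (hFy y)
    _ = _ := by
        rw [lpN_const_mul hp hC₃]
        simp only [mul_assoc]

lemma lpN_lpN_shearedAverage_le_of_gt {s : ℝ} {p q : ℝ≥0∞} (hq : 1 ≤ q) (hqp : q < p)
    (hs : (n : ℝ) * (q⁻¹.toReal - p⁻¹.toReal) < s) (hs0 : 0 ≤ s) :
    ∃ C : ℝ≥0∞, C ≠ ∞ ∧ ∀ F : 𝔼 → 𝔼 → ℝ≥0∞, Measurable (Function.uncurry F) →
      lpN p (fun x => lpN q (shearedAverage F x)) ≤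
        C * lpN p (fun x => lpN q fun ξ => ENNReal.ofReal (jp s ξ) * F x ξ) := by
  have hp : 1 ≤ p := hq.trans hqp.le
  obtain ⟨C₁, hC₁, h₁⟩ := lpN_le_lpN_jp_mul (n := n) hq hqp hs
  obtain ⟨C₂, hC₂, h₂⟩ := lpN_lpN_sheared_gaussConv_le (n := n) (c := 1 / 20) (by norm_num) hp
  obtain ⟨C₃, hC₃, h₃⟩ := jp_mul_gaussConv_le (n := n) hs0
  obtain ⟨C₄, hC₄, h₄⟩ := lpN_gaussConv_le (n := n) (c := 1 / 80) (by norm_num) hq hqp.ne_top hqp.le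
  refine ⟨C₁ * (C₂ * (C₃ * C₄)), ENNReal.mul_ne_top hC₁ (ENNReal.mul_ne_top hC₂
    (ENNReal.mul_ne_top hC₃ hC₄)), fun F hF => ?_⟩
  have hFy : ∀ y : 𝔼, Measurable (F y) := fun y => hF.comp (measurable_prodMk_left (x := y))
  have hΨ : Measurable (Function.uncurry fun y ξ : 𝔼 => gaussConv (1 / 40) (F y) ξ) := by
    have hF' : Measurable fun w : (𝔼 × 𝔼) × 𝔼 => F w.1.1 w.2 :=
      hF.comp (f := fun w : (𝔼 × 𝔼) × 𝔼 => (w.1.1, w.2)) (by fun_prop)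
    exact Measurable.lintegral_prod_right' (f := fun w : (𝔼 × 𝔼) × 𝔼 =>
      gaussKernel (1 / 40) (w.1.2 - w.2) * F w.1.1 w.2) (by fun_prop)
  have hΦ : Measurable (Function.uncurry fun y ξ : 𝔼 =>
      ENNReal.ofReal (jp s ξ) * gaussConv (1 / 40) (F y) ξ) :=
    ((measurable_jp s).comp measurable_snd).mul hΨ
  calc lpN p (fun x => lpN q (shearedAverage F x))
      ≤ lpN p (fun x => C₁ * lpN p fun ξ => gaussConv (1 / 20)
          (fun y => ENNReal.ofReal (jp s ξ) * gaussConv (1 / 40) (F y) ξ) (x - (2 : ℝ) • ξ)) := by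
        refine lpN_mono fun x => (lpN_mono (shearedAverage_le_shear_gaussConv hF x)).trans ?_
        refine (h₁ _ (measurable_sheared_gaussConv _ hΨ x)).trans (le_of_eq ?_)
        congr 2
        ext ξ
        rw [gaussConv, gaussConv, ← lintegral_const_mul' _ _ ENNReal.ofReal_ne_top]
        exact lintegral_congr fun y => mul_left_comm _ _ _
    _ ≤ C₁ * (C₂ * lpN p (fun y => C₃ * (C₄ * lpN q fun ξ =>
          ENNReal.ofReal (jp s ξ) * F y ξ))) := by
        rw [lpN_const_mul hp hC₁]
        refine mul_le_mul' le_rfl ((h₂ _ hΦ).trans (mul_le_mul' le_rfl ?_))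
        refine lpN_mono fun y => (lpN_mono fun ξ => h₃ (F y) ξ).trans ?_
        rw [lpN_const_mul hp hC₃]
        exact mul_le_mul' le_rfl (h₄ _ ((measurable_jp s).mul (hFy y)))
    _ = _ := by
        rw [lpN_const_mul hp hC₃, lpN_const_mul hp hC₄]
        simp only [mul_assoc]

end Boundedness

/-- For `n ≥ 1`, `s ∈ ℝ`, `1 ≤ p, q ≤ ∞` with `p ≠ q`: if `s > n |1/p - 1/q|`
(with `1/∞ = 0`), then `e^{iΔ}` is bounded from `W^s_{p,q}` to `W_{p,q}`. -/
theorem schrodinger_wiener_bounded_of_gt (n : ℕ) (hn : 1 ≤ n) (s : ℝ) (p q : ℝ≥0∞)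
    (hp : 1 ≤ p) (hq : 1 ≤ q) (hpq : p ≠ q)
    (hs : (n : ℝ) * |p⁻¹.toReal - q⁻¹.toReal| < s) :
    ∃ C : ℝ, 0 < C ∧ ∀ f : SchwartzMap (EuclideanSpace ℝ (Fin n)) ℂ,
      WNorm 0 p q (schrod 1 ⇑f) ≤ ENNReal.ofReal C * WNorm s p q ⇑f := by
  obtain ⟨A, hA, hstft⟩ := enorm_stft_schrod_le (n := n)
  have havg : ∃ C : ℝ≥0∞, C ≠ ∞ ∧ ∀ F : EuclideanSpace ℝ (Fin n) → EuclideanSpace ℝ (Fin n) → ℝ≥0∞,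
      Measurable (Function.uncurry F) → lpN p (fun x => lpN q (shearedAverage F x)) ≤
        C * lpN p (fun x => lpN q fun ξ => ENNReal.ofReal (jp s ξ) * F x ξ) := by
    have hs0 : 0 ≤ s := le_trans (by positivity) hs.le
    rcases lt_or_gt_of_ne hpq with h | h
    · exact lpN_lpN_shearedAverage_le_of_lt hp h
        (lt_of_le_of_lt (by gcongr; exact le_abs_self _) hs)
    · refine lpN_lpN_shearedAverage_le_of_gt hq h (lt_of_le_of_lt ?_ hs) hs0
      rw [abs_sub_comm]
      gcongr
      exact le_abs_self _
  obtain ⟨B, hB, havg⟩ := havg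
  refine ⟨(A * B).toReal + 1, by positivity, fun f => ?_⟩
  calc WNorm 0 p q (schrod 1 ⇑f)
      ≤ lpN p (fun x => A * lpN q (shearedAverage (fun y η => ‖STFT gauss f y η‖ₑ) x)) := by
        rw [WNorm_zero]
        refine lpN_mono fun x => ?_
        rw [← lpN_const_mul hq hA]
        exact lpN_mono fun ξ => hstft f x ξ
    _ ≤ A * (B * WNorm s p q f) := by
        rw [lpN_const_mul hp hA]
        exact mul_le_mul' le_rfl (havg _ (measurable_stft_gauss f.continuous))
    _ ≤ _ := by
        rw [← mul_assoc]
        refine mul_le_mul' ?_ le_rfl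
        exact (ENNReal.ofReal_toReal (ENNReal.mul_ne_top hA hB)).symm.le.trans
          (ENNReal.ofReal_le_ofReal (by linarith))

end
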